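/- Let S be a semigroup and T a subsemigroup of S such that S \ T is finite (T has finite Rees index in S). Then S is automatic if and only if T is automatic. -/

import Mathlib

namespace AutoSg

/-- Evaluation of a nonempty word over alphabet `A` in a semigroup `S`
via the letter-interpretation map `ψ`; the empty word evaluates to `none`. -/
def evalWord {S : Type*} [Semigroup S] {A : Type*} (ψ : A → S) : List A → Option S
  | [] => none
  | a :: w => some ((w.map ψ).foldl (· * ·) (ψ a))

/-- The standard padding map `δ_A` on pairs of words, with `none` playing
the role of the padding symbol `$`. -/
def padMap {A : Type*} (u v : List A) : List (Option A × Option A) :=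
  List.zipWith Prod.mk (u.map some ++ List.replicate (v.length - u.length) none)
    (v.map some ++ List.replicate (u.length - v.length) none)

/-- `(A, L)` is an automatic structure for the semigroup `S` with respect to `ψ`. -/
structure IsAutomaticStructure (S : Type*) [Semigroup S] {A : Type*} [Finite A]
    (ψ : A → S) (L : Language A) : Prop where
  nonempty_words : ∀ w ∈ L, w ≠ []
  regular : L.IsRegular
  onto : ∀ s : S, ∃ w ∈ L, evalWord ψ w = some s
  eq_regular : Language.IsRegular
    {p : List (Option A × Option A) |
      ∃ u ∈ L, ∃ v ∈ L, p = padMap u v ∧ evalWord ψ u = evalWord ψ v}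
  mul_regular : ∀ a : A, Language.IsRegular
    {p : List (Option A × Option A) |
      ∃ u ∈ L, ∃ v ∈ L, p = padMap u v ∧ evalWord ψ (u ++ [a]) = evalWord ψ v}

/-- An automatic structure with uniqueness: each element of `S` is represented
by exactly one word of `L`. -/
structure IsAutomaticStructureWithUniqueness (S : Type*) [Semigroup S] {A : Type*} [Finite A]
    (ψ : A → S) (L : Language A) extends IsAutomaticStructure S ψ L : Prop where
  unique : ∀ u ∈ L, ∀ v ∈ L, evalWord ψ u = evalWord ψ v → u = v

/-- A semigroup is automatic if it admits an automatic structure. -/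
def IsAutomaticSemigroup (S : Type*) [Semigroup S] : Prop :=
  ∃ (A : Type) (_ : Finite A) (ψ : A → S) (L : Language A), IsAutomaticStructure S ψ L

end AutoSg

namespace Language

variable {α β : Type*}

theorem isRegular_of_invariant {L : Language α} {σ : Type*} [Finite σ] (f : List α → σ)
    (hf : ∀ x x', f x = f x' → ∀ y, x ++ y ∈ L → x' ++ y ∈ L) : L.IsRegular := by
  refine IsRegular.of_finite_range_leftQuotient ?_
  have : Finite (Set.range L.leftQuotient) := by
    refine Finite.of_injective (fun q => f q.2.choose) ?_
    intro q q' h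
    apply Subtype.ext
    rw [← q.2.choose_spec, ← q'.2.choose_spec]
    ext y
    exact ⟨hf _ _ h y, hf _ _ h.symm y⟩
  exact Set.toFinite _

theorem exists_dfa {L : Language α} (h : L.IsRegular) :
    ∃ (σ : Type) (_ : Fintype σ) (M : DFA α σ),
      ∀ x y, x ++ y ∈ L ↔ M.evalFrom (M.eval x) y ∈ M.accept := by
  obtain ⟨σ, _, M, rfl⟩ := h
  refine ⟨σ, ‹_›, M, fun x y => ?_⟩
  rw [DFA.mem_accepts]
  exact Iff.of_eq (congrArg (· ∈ M.accept) (DFA.evalFrom_of_append M M.start x y))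

theorem IsRegular.map {L : Language α} (h : L.IsRegular) (g : α → β) :
    (Language.map g L).IsRegular := by
  obtain ⟨σ, _, M, hM⟩ := exists_dfa h
  refine isRegular_of_invariant (σ := Set σ) (fun x => {s | ∃ u, u.map g = x ∧ M.eval u = s}) ?_
  rintro x x' hx y ⟨w, hw, hwy⟩
  obtain ⟨u, v, rfl, hu, hv⟩ := List.map_eq_append_iff.1 hwy
  have : M.eval u ∈ {s | ∃ u, u.map g = x' ∧ M.eval u = s} := hx ▸ ⟨u, hu, rfl⟩
  obtain ⟨u', hu', he⟩ := this
  refine ⟨u' ++ v, ?_, by simp [hu', hv]⟩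
  have h1 := (hM u v).1 hw
  rw [← he] at h1
  exact (hM _ _).2 h1

theorem IsRegular.mul {L₁ L₂ : Language α} (h₁ : L₁.IsRegular) (h₂ : L₂.IsRegular) :
    (L₁ * L₂).IsRegular := by
  obtain ⟨σ, _, M, hM⟩ := exists_dfa h₁
  obtain ⟨τ, _, N, hN⟩ := exists_dfa h₂
  refine isRegular_of_invariant (σ := σ × Set τ)
    (fun x => (M.eval x, {s | ∃ u v, u ∈ L₁ ∧ u ++ v = x ∧ N.eval v = s})) ?_
  intro x x' hx y hy
  obtain ⟨hx1, hx2⟩ := Prod.mk.inj hx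
  obtain ⟨u, hu, v, hv, huv⟩ := mem_mul.1 hy
  rcases List.append_eq_append_iff.1 huv with ⟨c, rfl, rfl⟩ | ⟨c, rfl, rfl⟩
  · have : N.eval c ∈ {s | ∃ u v, u ∈ L₁ ∧ u ++ v = x' ∧ N.eval v = s} := hx2 ▸ ⟨u, c, hu, rfl, rfl⟩
    obtain ⟨u', c', hu', rfl, hc⟩ := this
    refine mem_mul.2 ⟨u', hu', c' ++ y, ?_, by simp⟩
    have h1 := (hN c y).1 hv
    rw [← hc] at h1
    exact (hN _ _).2 h1
  · refine mem_mul.2 ⟨x' ++ c, ?_, v, hv, by simp⟩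
    have h1 := (hM x c).1 hu
    rw [hx1] at h1
    exact (hM _ _).2 h1

theorem IsRegular.congr {L K : Language α} (h : L.IsRegular) (e : ∀ x, x ∈ K ↔ x ∈ L) :
    K.IsRegular := by
  rwa [Language.ext e]

theorem isRegular_zero : (0 : Language α).IsRegular :=
  isRegular_of_invariant (σ := Unit) (fun _ => ()) fun _ _ _ _ h => h

theorem isRegular_singleton (w : List α) : ({w} : Language α).IsRegular := by
  refine IsRegular.of_finite_range_leftQuotient ?_
  refine Set.Finite.subset (s := insert (0 : Language α)
    ((fun s => ({s} : Language α)) '' {s | s ∈ w.tails}))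
    (((List.finite_toSet _).image _).insert _) ?_
  rintro _ ⟨x, rfl⟩
  by_cases hx : x <+: w
  · obtain ⟨s, rfl⟩ := hx
    refine Or.inr ⟨s, by simp, ?_⟩
    ext y
    exact ⟨fun h => by rw [Set.mem_singleton_iff.1 h]; rfl, fun h => List.append_cancel_left h⟩
  · refine Or.inl ?_
    ext y
    exact ⟨fun h => (hx ⟨y, h⟩).elim, fun h => h.elim⟩

theorem isRegular_forall_mem (P : α → Prop) :
    IsRegular ({w | ∀ a ∈ w, P a} : Language α) := by
  refine isRegular_of_invariant (σ := Prop) (fun x => ∀ a ∈ x, P a) ?_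
  intro x x' hx y hy a ha
  rcases List.mem_append.1 ha with h | h
  · exact hx.mp (fun b hb => hy b (List.mem_append_left _ hb)) a h
  · exact hy a (List.mem_append_right _ h)

theorem IsRegular.rightQuotient {L : Language α} (h : L.IsRegular) (K : Set (List α)) :
    IsRegular ({x | ∃ y ∈ K, x ++ y ∈ L} : Language α) := by
  obtain ⟨σ, _, M, hM⟩ := exists_dfa h
  refine isRegular_of_invariant M.eval ?_
  rintro x x' hx y ⟨z, hz, h⟩
  refine ⟨z, hz, ?_⟩
  rw [List.append_assoc] at h ⊢
  rw [hM] at h ⊢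
  rwa [← hx]

theorem IsRegular.comap_flatMap {L : Language β} (h : L.IsRegular) (g : α → List β) :
    IsRegular ({x | x.flatMap g ∈ L} : Language α) := by
  obtain ⟨σ, _, M, hM⟩ := exists_dfa h
  refine isRegular_of_invariant (fun x => M.eval (x.flatMap g)) ?_
  intro x x' hx y hy
  change (x ++ y).flatMap g ∈ L at hy
  change (x' ++ y).flatMap g ∈ L
  rw [List.flatMap_append, hM] at hy ⊢
  rwa [← hx]

theorem IsRegular.comap {L : Language β} (h : L.IsRegular) (g : α → β) :
    IsRegular ({x | x.map g ∈ L} : Language α) := by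
  simpa only [List.map_eq_flatMap] using h.comap_flatMap fun a => [g a]

theorem IsRegular.iUnion {ι : Type*} [Finite ι] {L : ι → Language α} (h : ∀ i, (L i).IsRegular) :
    IsRegular ({x | ∃ i, x ∈ L i} : Language α) := by
  choose σ _ M hM using fun i => exists_dfa (h i)
  refine isRegular_of_invariant (σ := ∀ i, σ i) (fun x i => (M i).eval x) ?_
  rintro x x' hx y ⟨i, hi⟩
  refine ⟨i, ?_⟩
  rw [hM] at hi ⊢
  rwa [← congrFun hx i]

end Language

namespace AutoSg

variable {α β γ δ : Type*}

/-- `l` is the word `u` followed by padding symbols. -/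
def Pads (l : List (Option α)) (u : List α) : Prop :=
  ∃ m, l = u.map some ++ List.replicate m none

theorem pads_nil_iff {u : List α} : Pads [] u ↔ u = [] := by
  constructor
  · rintro ⟨m, h⟩
    simpa using (List.append_eq_nil_iff.1 h.symm).1
  · rintro rfl
    exact ⟨0, rfl⟩

theorem pads_some_cons_iff {a : α} {l : List (Option α)} {u : List α} :
    Pads (some a :: l) u ↔ ∃ u', u = a :: u' ∧ Pads l u' := by
  constructor
  · rintro ⟨m, h⟩
    cases u with
    | nil => cases m <;> simp [List.replicate_succ] at h
    | cons b u =>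
      simp only [List.map_cons, List.cons_append, List.cons.injEq, Option.some.injEq] at h
      exact ⟨u, by rw [h.1], m, h.2⟩
  · rintro ⟨u', rfl, m, rfl⟩
    exact ⟨m, rfl⟩

theorem pads_none_cons_iff {l : List (Option α)} {u : List α} :
    Pads (none :: l) u ↔ u = [] ∧ Pads l [] := by
  constructor
  · rintro ⟨m, h⟩
    cases u with
    | nil =>
      cases m with
      | zero => simp at h
      | succ m => exact ⟨rfl, m, by simpa [List.replicate_succ] using h⟩
    | cons b u => simp at h
  · rintro ⟨rfl, m, rfl⟩
    exact ⟨m + 1, rfl⟩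

theorem Pads.unique {l : List (Option α)} {u v : List α} (hu : Pads l u) (hv : Pads l v) :
    u = v := by
  induction l generalizing u v with
  | nil => rw [pads_nil_iff.1 hu, pads_nil_iff.1 hv]
  | cons o l ih =>
    cases o with
    | none => rw [(pads_none_cons_iff.1 hu).1, (pads_none_cons_iff.1 hv).1]
    | some a =>
      obtain ⟨u', rfl, hu'⟩ := pads_some_cons_iff.1 hu
      obtain ⟨v', rfl, hv'⟩ := pads_some_cons_iff.1 hv
      rw [ih hu' hv']

theorem pads_append_replicate_iff {l : List (Option α)} {k : ℕ} {u : List α} :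
    Pads (l ++ List.replicate k none) u ↔ Pads l u := by
  induction l generalizing u with
  | nil =>
    rw [List.nil_append, pads_nil_iff]
    constructor
    · exact fun h => h.unique ⟨k, rfl⟩
    · rintro rfl
      exact ⟨k, rfl⟩
  | cons o l ih =>
    cases o <;> simp only [List.cons_append, pads_none_cons_iff, pads_some_cons_iff, ih]

theorem pads_map_some_append_iff {x : List α} {l : List (Option α)} {u : List α} :
    Pads (x.map some ++ l) u ↔ ∃ y, u = x ++ y ∧ Pads l y := by
  induction x generalizing u with
  | nil => simp
  | cons a x ih =>
    simp only [List.map_cons, List.cons_append, pads_some_cons_iff, ih]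
    constructor
    · rintro ⟨_, rfl, y, rfl, h⟩
      exact ⟨y, rfl, h⟩
    · rintro ⟨y, rfl, h⟩
      exact ⟨_, rfl, y, rfl, h⟩

theorem pads_map_some (u : List α) : Pads (u.map some) u := ⟨0, by simp⟩

theorem Pads.map {l : List (Option α)} {u : List α} (h : Pads l u) (f : α → β) :
    Pads (l.map (Option.map f)) (u.map f) := by
  obtain ⟨m, rfl⟩ := h
  exact ⟨m, by simp⟩

theorem Pads.length_le {l : List (Option α)} {u : List α} (h : Pads l u) :
    u.length ≤ l.length := by
  obtain ⟨m, rfl⟩ := h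
  simp

theorem Pads.eq_of_length {l l' : List (Option α)} {u : List α} (h : Pads l u) (h' : Pads l' u)
    (hl : l.length = l'.length) : l = l' := by
  obtain ⟨m, rfl⟩ := h
  obtain ⟨n, rfl⟩ := h'
  simp only [List.length_append, List.length_replicate, Nat.add_left_cancel_iff] at hl
  rw [hl]

theorem Pads.getElem {l : List (Option α)} {u : List α} (h : Pads l u) {i : ℕ}
    (hi : i < l.length) : l[i] = u[i]? := by
  obtain ⟨m, rfl⟩ := h
  rw [List.getElem_append]
  split_ifs with h'
  · simp_all
  · simp at h'
    simp [h']

theorem exists_pads (u : List α) {n : ℕ} (h : u.length ≤ n) :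
    ∃ l : List (Option α), l.length = n ∧ Pads l u :=
  ⟨u.map some ++ List.replicate (n - u.length) none, by simp; omega, _, rfl⟩

theorem padMap_pads (u v : List α) :
    Pads ((padMap u v).map Prod.fst) u ∧ Pads ((padMap u v).map Prod.snd) v := by
  have h : padMap u v = List.zip (u.map some ++ List.replicate (v.length - u.length) none)
    (v.map some ++ List.replicate (u.length - v.length) none) := rfl
  rw [h, List.map_fst_zip (by simp; omega), List.map_snd_zip (by simp; omega)]
  exact ⟨⟨_, rfl⟩, ⟨_, rfl⟩⟩

theorem eq_padMap_append {p : List (Option α × Option α)} {u v : List α}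
    (hu : Pads (p.map Prod.fst) u) (hv : Pads (p.map Prod.snd) v) :
    ∃ m, p = padMap u v ++ List.replicate m (none, none) := by
  induction p generalizing u v with
  | nil =>
    rw [pads_nil_iff.1 hu, pads_nil_iff.1 hv]
    exact ⟨0, rfl⟩
  | cons o p ih =>
    obtain ⟨o₁, o₂⟩ := o
    simp only [List.map_cons] at hu hv
    cases o₁ with
    | none =>
      obtain ⟨rfl, hu'⟩ := pads_none_cons_iff.1 hu
      cases o₂ with
      | none =>
        obtain ⟨rfl, hv'⟩ := pads_none_cons_iff.1 hv
        obtain ⟨m, rfl⟩ := ih hu' hv'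
        exact ⟨m + 1, by simp [padMap, List.replicate_succ]⟩
      | some b =>
        obtain ⟨v, rfl, hv'⟩ := pads_some_cons_iff.1 hv
        obtain ⟨m, rfl⟩ := ih hu' hv'
        exact ⟨m, by simp [padMap, List.replicate_succ]⟩
    | some a =>
      obtain ⟨u, rfl, hu'⟩ := pads_some_cons_iff.1 hu
      cases o₂ with
      | none =>
        obtain ⟨rfl, hv'⟩ := pads_none_cons_iff.1 hv
        obtain ⟨m, rfl⟩ := ih hu' hv'
        exact ⟨m, by simp [padMap, List.replicate_succ]⟩
      | some b =>
        obtain ⟨v, rfl, hv'⟩ := pads_some_cons_iff.1 hv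
        obtain ⟨m, rfl⟩ := ih hu' hv'
        exact ⟨m, by simp [padMap]⟩

theorem none_none_notMem_padMap (u v : List α) :
    ((none, none) : Option α × Option α) ∉ padMap u v := by
  induction u generalizing v with
  | nil =>
    intro h
    have := List.of_mem_zip h
    simp at this
  | cons a u ih =>
    cases v with
    | nil =>
      intro h
      have := List.of_mem_zip h
      simp at this
    | cons b v => simpa [padMap] using ih v

/-- All padded representations, of any sufficient length, of the pairs in a relation. -/
def padLang (R : List α → List β → Prop) : Language (Option α × Option β) :=
  {p | ∃ u v, R u v ∧ Pads (p.map Prod.fst) u ∧ Pads (p.map Prod.snd) v}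

/-- A relation between words is regular if it is recognised synchronously by a finite automaton. -/
def RegRel (R : List α → List β → Prop) : Prop := (padLang R).IsRegular

theorem mem_padLang {R : List α → List β → Prop} {p : List (Option α × Option β)} :
    p ∈ padLang R ↔ ∃ u v, R u v ∧ Pads (p.map Prod.fst) u ∧ Pads (p.map Prod.snd) v := Iff.rfl

theorem isRegular_padMap_iff {R : List α → List α → Prop} :
    Language.IsRegular {p | ∃ u v, R u v ∧ p = padMap u v} ↔ RegRel R := by
  constructor
  · intro h
    have := h.mul (Language.isRegular_forall_mem fun a => a = ((none, none) : Option α × Option α))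
    refine this.congr fun p => ?_
    constructor
    · rintro ⟨u, v, hR, hu, hv⟩
      obtain ⟨m, rfl⟩ := eq_padMap_append hu hv
      exact ⟨_, ⟨u, v, hR, rfl⟩, _, fun _ => List.eq_of_mem_replicate, rfl⟩
    · rintro ⟨_, ⟨u, v, hR, rfl⟩, z, hz, rfl⟩
      rw [List.eq_replicate_of_mem hz]
      refine ⟨u, v, hR, ?_, ?_⟩ <;>
        simp only [List.map_append, List.map_replicate, pads_append_replicate_iff]
      · exact (padMap_pads u v).1
      · exact (padMap_pads u v).2
  · intro h
    have := Language.IsRegular.inf h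
      (Language.isRegular_forall_mem fun a => a ≠ ((none, none) : Option α × Option α))
    refine this.congr fun p => ?_
    constructor
    · rintro ⟨u, v, hR, rfl⟩
      exact ⟨⟨u, v, hR, padMap_pads u v⟩,
        fun a ha h => none_none_notMem_padMap u v (h ▸ ha)⟩
    · rintro ⟨⟨u, v, hR, hu, hv⟩, hp⟩
      obtain ⟨m, rfl⟩ := eq_padMap_append hu hv
      refine ⟨u, v, hR, ?_⟩
      cases m with
      | zero => simp
      | succ m => exact (hp (none, none) (by simp [List.replicate_succ]) rfl).elim

theorem RegRel.of_iff {R S : List α → List β → Prop} (h : RegRel R) (hRS : ∀ u v, S u v ↔ R u v) :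
    RegRel S := by
  rwa [show S = R from funext fun u => funext fun v => propext (hRS u v)]

theorem RegRel.iUnion {ι : Type*} [Finite ι] {R : ι → List α → List β → Prop}
    (h : ∀ i, RegRel (R i)) : RegRel fun u v => ∃ i, R i u v := by
  refine (Language.IsRegular.iUnion h).congr fun p => ?_
  constructor
  · rintro ⟨u, v, ⟨i, h⟩, h'⟩
    exact ⟨i, u, v, h, h'⟩
  · rintro ⟨i, u, v, h, h'⟩
    exact ⟨u, v, ⟨i, h⟩, h'⟩

theorem RegRel.or {R S : List α → List β → Prop} (hR : RegRel R) (hS : RegRel S) :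
    RegRel fun u v => R u v ∨ S u v := by
  refine (RegRel.iUnion (R := fun i : Bool => cond i R S)
    (by rintro (_ | _) <;> assumption)).of_iff ?_
  simp [or_comm]

theorem RegRel.and {R S : List α → List β → Prop} (hR : RegRel R) (hS : RegRel S) :
    RegRel fun u v => R u v ∧ S u v := by
  refine (Language.IsRegular.inf hR hS).congr fun p => ?_
  constructor
  · rintro ⟨u, v, ⟨h, h'⟩, hp⟩
    exact ⟨⟨u, v, h, hp⟩, ⟨u, v, h', hp⟩⟩
  · rintro ⟨⟨u, v, h, hu, hv⟩, ⟨u', v', h', hu', hv'⟩⟩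
    obtain rfl := hu.unique hu'
    obtain rfl := hv.unique hv'
    exact ⟨u, v, ⟨h, h'⟩, hu, hv⟩

theorem RegRel.swap {R : List α → List β → Prop} (hR : RegRel R) : RegRel fun v u => R u v := by
  refine (Language.IsRegular.comap hR (Prod.swap : Option β × Option α → _)).congr fun p => ?_
  change _ ↔ p.map Prod.swap ∈ padLang R
  simp only [mem_padLang, List.map_map]
  constructor
  · rintro ⟨v, u, h, hv, hu⟩
    exact ⟨u, v, h, hu, hv⟩
  · rintro ⟨u, v, h, hu, hv⟩
    exact ⟨v, u, h, hv, hu⟩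

theorem isRegular_pads {L : Language α} (h : L.IsRegular) :
    Language.IsRegular {l : List (Option α) | ∃ u ∈ L, Pads l u} := by
  refine ((h.map some).mul
    (Language.isRegular_forall_mem fun a => a = (none : Option α))).congr fun l => ?_
  constructor
  · rintro ⟨u, hu, m, rfl⟩
    exact ⟨_, ⟨u, hu, rfl⟩, _, fun _ => List.eq_of_mem_replicate, rfl⟩
  · rintro ⟨_, ⟨u, hu, rfl⟩, z, hz, rfl⟩
    rw [List.eq_replicate_of_mem hz]
    exact ⟨u, hu, _, rfl⟩

theorem RegRel.prod {L : Language α} {K : Language β} (hL : L.IsRegular) (hK : K.IsRegular) :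
    RegRel fun u v => u ∈ L ∧ v ∈ K := by
  refine (((isRegular_pads hL).comap (Prod.fst : Option α × Option β → _)).inf
    ((isRegular_pads hK).comap (Prod.snd : Option α × Option β → _))).congr fun p => ?_
  constructor
  · rintro ⟨u, v, ⟨hu, hv⟩, h, h'⟩
    exact ⟨⟨u, hu, h⟩, ⟨v, hv, h'⟩⟩
  · rintro ⟨⟨u, hu, h⟩, ⟨v, hv, h'⟩⟩
    exact ⟨u, v, ⟨hu, hv⟩, h, h'⟩

theorem RegRel.comp {R : List α → List β → Prop} {S : List β → List γ → Prop}
    (hR : RegRel R) (hS : RegRel S) : RegRel fun u w => ∃ v, R u v ∧ S v w := by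
  let π₁ : (Option α × Option γ) × Option β → Option α × Option β := fun x => (x.1.1, x.2)
  let π₂ : (Option α × Option γ) × Option β → Option β × Option γ := fun x => (x.2, x.1.2)
  have h := ((((Language.IsRegular.comap hR π₁).inf
    (Language.IsRegular.comap hS π₂)).map Prod.fst).rightQuotient
    {z | ∃ k, z = List.replicate k (none, none)})
  refine (h).congr fun p => ?_
  constructor
  · rintro ⟨u, w, ⟨v, hR, hS⟩, hu, hw⟩
    obtain ⟨l, hl, hv⟩ := exists_pads v (Nat.le_add_left v.length p.length)
    set p' := p ++ List.replicate v.length (none, none) with hp'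
    have hlen : p'.length = l.length := by simp [hp', hl]
    have e₁ : (List.zip p' l).map Prod.fst = p' := List.map_fst_zip hlen.le
    have e₂ : (List.zip p' l).map Prod.snd = l := List.map_snd_zip hlen.ge
    have hu' : Pads (p'.map Prod.fst) u := by
      simpa [hp', pads_append_replicate_iff] using hu
    have hw' : Pads (p'.map Prod.snd) w := by
      simpa [hp', pads_append_replicate_iff] using hw
    refine ⟨_, ⟨v.length, rfl⟩, List.zip p' l,
      Language.mem_inf.2 ⟨⟨u, v, hR, ?_⟩, ⟨v, w, hS, ?_⟩⟩, e₁⟩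
    · rw [← e₁, List.map_map] at hu'
      rw [← e₂] at hv
      rw [List.map_map, List.map_map]
      exact ⟨hu', hv⟩
    · rw [← e₁, List.map_map] at hw'
      rw [← e₂] at hv
      rw [List.map_map, List.map_map]
      exact ⟨hv, hw'⟩
  · rintro ⟨_, ⟨k, rfl⟩, q, hq, hqp⟩
    obtain ⟨⟨u, v, hR, hu, hv⟩, ⟨v', w, hS, hv', hw⟩⟩ := Language.mem_inf.1 hq
    rw [List.map_map] at hu hv hv' hw
    obtain rfl : v = v' := hv.unique hv'
    refine ⟨u, w, ⟨v, hR, hS⟩, ?_, ?_⟩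
    · rw [← pads_append_replicate_iff (k := k)]
      have := congrArg (List.map Prod.fst) hqp
      rw [List.map_append, List.map_replicate, List.map_map] at this
      rw [← this]
      exact hu
    · rw [← pads_append_replicate_iff (k := k)]
      have := congrArg (List.map Prod.snd) hqp
      rw [List.map_append, List.map_replicate, List.map_map] at this
      rw [← this]
      exact hw

theorem RegRel.dom {R : List α → List β → Prop} (hR : RegRel R) :
    Language.IsRegular {u | ∃ v, R u v} := by
  refine (((Language.IsRegular.map hR Prod.fst).rightQuotient
    {z | ∃ k, z = List.replicate k none}).comap some).congr fun u => ?_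
  constructor
  · rintro ⟨v, hv⟩
    obtain ⟨l, hl, hlu⟩ := exists_pads v (Nat.le_add_left v.length u.length)
    have hlen : (u.map some ++ List.replicate v.length none).length = l.length := by simp [hl]
    refine ⟨_, ⟨v.length, rfl⟩, List.zip _ l, ⟨u, v, hv, ?_, ?_⟩, List.map_fst_zip hlen.le⟩
    · rw [List.map_fst_zip hlen.le]
      exact ⟨_, rfl⟩
    · rwa [List.map_snd_zip hlen.ge]
  · rintro ⟨_, ⟨k, rfl⟩, q, ⟨u', v, h, hu, hv⟩, hq⟩
    rw [hq, pads_append_replicate_iff] at hu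
    rw [(pads_map_some u).unique hu]
    exact ⟨v, h⟩

theorem RegRel.prepend {L : Language α} {R : List α → List β → Prop} (hL : L.IsRegular)
    (hR : RegRel R) (g : α → β) :
    RegRel fun u v => ∃ x ∈ L, ∃ y z, R y z ∧ u = x ++ y ∧ v = x.map g ++ z := by
  refine (Language.IsRegular.mul (hL.map fun a => (some a, some (g a))) hR).congr fun p => ?_
  constructor
  · rintro ⟨_, _, ⟨x, hx, y, z, h, rfl, rfl⟩, hu, hv⟩
    clear hL hR
    suffices H : ∃ q, q ∈ padLang R ∧ x.map (fun a => (some a, some (g a))) ++ q = p by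
      obtain ⟨q, hq, rfl⟩ := H
      exact ⟨_, ⟨x, hx, rfl⟩, q, hq, rfl⟩
    clear hx
    induction x generalizing p with
    | nil => exact ⟨p, ⟨y, z, h, hu, hv⟩, rfl⟩
    | cons a x ih =>
      obtain ⟨m, hm⟩ := hu
      obtain ⟨n, hn⟩ := hv
      cases p with
      | nil => simp at hm
      | cons o p =>
        simp only [List.map_cons, List.cons_append, List.cons.injEq] at hm hn
        obtain ⟨q, hq, rfl⟩ := ih p ⟨m, hm.2⟩ ⟨n, hn.2⟩
        exact ⟨q, hq, by
          rw [List.map_cons, List.cons_append,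
            show o = (some a, some (g a)) from Prod.ext hm.1 hn.1]⟩
  · rintro ⟨_, ⟨x, hx, rfl⟩, q, ⟨y, z, h, hy, hz⟩, rfl⟩
    refine ⟨_, _, ⟨x, hx, y, z, h, rfl, rfl⟩, ?_, ?_⟩
    · rw [List.map_append, List.map_map]
      exact pads_map_some_append_iff.2 ⟨y, rfl, hy⟩
    · rw [List.map_append, List.map_map,
        show Prod.snd ∘ (fun a => (some a, some (g a))) = some ∘ g from rfl, ← List.map_map]
      exact pads_map_some_append_iff.2 ⟨z, rfl, hz⟩

theorem RegRel.map {R : List α → List β → Prop} (hR : RegRel R) (f : α → γ) (g : β → δ) :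
    RegRel fun u v => ∃ x y, R x y ∧ u = x.map f ∧ v = y.map g := by
  refine (Language.IsRegular.map hR (Prod.map (Option.map f) (Option.map g))).congr fun p => ?_
  constructor
  · rintro ⟨_, _, ⟨x, y, h, rfl, rfl⟩, hu, hv⟩
    obtain ⟨l, hl, hx⟩ := exists_pads x (n := p.length) (by simpa using hu.length_le)
    obtain ⟨l', hl', hy⟩ := exists_pads y (n := p.length) (by simpa using hv.length_le)
    have e₁ : (List.zip l l').map Prod.fst = l := List.map_fst_zip (by omega)
    have e₂ : (List.zip l l').map Prod.snd = l' := List.map_snd_zip (by omega)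
    refine ⟨List.zip l l', ⟨x, y, h, by rwa [e₁], by rwa [e₂]⟩, ?_⟩
    rw [← List.zip_map, (hx.map f).eq_of_length hu (by simpa using hl),
      (hy.map g).eq_of_length hv (by simpa using hl')]
    exact (List.zip_of_prod rfl rfl).symm
  · rintro ⟨q, ⟨x, y, h, hx, hy⟩, rfl⟩
    refine ⟨_, _, ⟨x, y, h, rfl, rfl⟩, ?_, ?_⟩
    · rw [List.map_map]
      have := hx.map f
      rw [List.map_map] at this
      exact this
    · rw [List.map_map]
      have := hy.map g
      rw [List.map_map] at this
      exact this

theorem regRel_true : RegRel fun (_ : List α) (_ : List β) => True :=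
  (RegRel.prod (Language.isRegular_forall_mem fun _ => True)
    (Language.isRegular_forall_mem fun _ => True)).of_iff fun _ _ =>
      ⟨fun _ => ⟨fun _ _ => trivial, fun _ _ => trivial⟩, fun _ => trivial⟩

theorem regRel_length_lt : RegRel fun (u : List α) (v : List β) => v.length < u.length := by
  refine (Language.IsRegular.inf regRel_true (Language.isRegular_forall_mem
    fun a : Option α × Option β => a.1 ≠ none → a.2 ≠ none).compl).congr fun p => ?_
  have key {u v} (hu : Pads (p.map Prod.fst) u) (hv : Pads (p.map Prod.snd) v) :
      v.length < u.length ↔ ¬ ∀ a ∈ p, a.1 ≠ none → a.2 ≠ none := by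
    push Not
    constructor
    · intro h
      have hp : v.length < p.length := by simpa using h.trans_le hu.length_le
      refine ⟨p[v.length], List.getElem_mem _, ?_, ?_⟩
      · have := hu.getElem (i := v.length) (by simpa using hp)
        rw [List.getElem_map] at this
        simpa [this] using h
      · have := hv.getElem (i := v.length) (by simpa using hp)
        rw [List.getElem_map] at this
        simp [this]
    · rintro ⟨a, ha, h₁, h₂⟩
      obtain ⟨i, hi, rfl⟩ := List.mem_iff_getElem.1 ha
      have e₁ := hu.getElem (i := i) (by simpa using hi)
      have e₂ := hv.getElem (i := i) (by simpa using hi)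
      rw [List.getElem_map] at e₁ e₂
      rw [e₁] at h₁
      rw [e₂] at h₂
      simp at h₁ h₂
      omega
  constructor
  · rintro ⟨u, v, h, hu, hv⟩
    exact ⟨⟨u, v, trivial, hu, hv⟩, (key hu hv).1 h⟩
  · rintro ⟨⟨u, v, -, hu, hv⟩, hp⟩
    exact ⟨u, v, (key hu hv).2 hp, hu, hv⟩

/-- Letters standing for words of length at most `K`, expanded to padded words of length `K`. -/
def blockPad (K : ℕ) (h : γ → List α) : Option γ → List (Option α)
  | none => List.replicate K none
  | some c => (h c).map some ++ List.replicate (K - (h c).length) none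

theorem length_blockPad {K : ℕ} {h : γ → List α} (hK : ∀ c, (h c).length ≤ K) (o : Option γ) :
    (blockPad K h o).length = K := by
  cases o with
  | none => simp [blockPad]
  | some c => simp [blockPad, hK c]

theorem Pads.flatMap_blockPad {K : ℕ} {h : γ → List α} {l : List (Option γ)} {w : List γ}
    (hl : Pads l w) (u : List α) :
    Pads (l.flatMap (blockPad K h)) u ↔ Pads (w.flatMap fun c => blockPad K h (some c)) u := by
  obtain ⟨m, rfl⟩ := hl
  rw [List.flatMap_append, List.flatMap_replicate, List.flatMap_map, blockPad,
    List.flatten_replicate_replicate, pads_append_replicate_iff]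

theorem RegRel.comap_blockPad {R : List α → List β → Prop} (hR : RegRel R) {K : ℕ}
    {h : γ → List α} {h' : δ → List β} (hK : ∀ c, (h c).length ≤ K)
    (hK' : ∀ c, (h' c).length ≤ K) :
    RegRel fun w w' => ∃ u u', R u u' ∧ Pads (w.flatMap fun c => blockPad K h (some c)) u ∧
      Pads (w'.flatMap fun c => blockPad K h' (some c)) u' := by
  let g : Option γ × Option δ → List (Option α × Option β) :=
    fun c => List.zip (blockPad K h c.1) (blockPad K h' c.2)
  have g₁ (p : List (Option γ × Option δ)) :
      (p.flatMap g).map Prod.fst = (p.map Prod.fst).flatMap (blockPad K h) := by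
    rw [List.map_flatMap, List.flatMap_map]
    congr 1
    ext1 c
    exact List.map_fst_zip (by rw [length_blockPad hK, length_blockPad hK'])
  have g₂ (p : List (Option γ × Option δ)) :
      (p.flatMap g).map Prod.snd = (p.map Prod.snd).flatMap (blockPad K h') := by
    rw [List.map_flatMap, List.flatMap_map]
    congr 1
    ext1 c
    exact List.map_snd_zip (by rw [length_blockPad hK, length_blockPad hK'])
  refine (Language.IsRegular.inf regRel_true (Language.IsRegular.comap_flatMap hR g)).congr
    fun p => ?_
  constructor
  · rintro ⟨w, w', ⟨u, u', h, hu, hu'⟩, hw, hw'⟩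
    refine ⟨⟨w, w', trivial, hw, hw'⟩, u, u', h, ?_, ?_⟩
    · rwa [g₁, hw.flatMap_blockPad]
    · rwa [g₂, hw'.flatMap_blockPad]
  · rintro ⟨⟨w, w', -, hw, hw'⟩, u, u', h, hu, hu'⟩
    rw [g₁, hw.flatMap_blockPad] at hu
    rw [g₂, hw'.flatMap_blockPad] at hu'
    exact ⟨w, w', ⟨u, u', h, hu, hu'⟩, hw, hw'⟩

/-- Words whose letters, other than the last one, all stand for words of length `K`. -/
def IsChopped (K : ℕ) (h : β → List α) (t : List β) : Prop :=
  ∃ x c, t = x ++ [c] ∧ ∀ b ∈ x, (h b).length = K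

theorem RegRel.comap_chopped [Finite α] [Finite β] {R : List α → List α → Prop} (hR : RegRel R)
    {K : ℕ} {h : β → List α} (hK : ∀ b, (h b).length ≤ 2 * K) :
    RegRel fun t t' => IsChopped K h t ∧ IsChopped K h t' ∧ R (t.flatMap h) (t'.flatMap h) := by
  let Γ := {l : List α // l.length ≤ K}
  let i : Γ → List α := Subtype.val
  let fst : β → Γ := fun b => ⟨(h b).take K, by simp⟩
  let snd : β → Γ := fun b => ⟨(h b).drop K, by have := hK b; simp; omega⟩
  have hE := (RegRel.iUnion fun c : β => RegRel.prod (Language.isRegular_singleton [c])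
    (Language.isRegular_singleton [fst c, snd c])).prepend
      (Language.isRegular_forall_mem fun b => (h b).length = K) fst
  have hpad {t : List β} {w : List Γ} (x) (hx : ∀ b ∈ x, (h b).length = K) (c)
      (ht : t = x ++ [c]) (hw : w = x.map fst ++ [fst c, snd c]) :
      Pads (w.flatMap fun c => blockPad K i (some c)) (t.flatMap h) := by
    subst ht hw
    rw [List.flatMap_append, List.flatMap_append]
    have hx' : (x.map fst).flatMap (fun c => blockPad K i (some c)) = (x.flatMap h).map some := by
      rw [List.map_flatMap, List.flatMap_map]
      refine List.flatMap_congr fun b hb => ?_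
      simp [blockPad, i, fst, hx b hb]
    rw [hx', pads_map_some_append_iff]
    refine ⟨_, rfl, ?_⟩
    rcases le_total K (h c).length with hc | hc
    · rw [List.flatMap_cons, List.flatMap_singleton, List.flatMap_singleton]
      simp only [blockPad, i, fst, snd, List.length_take, min_eq_left hc, Nat.sub_self,
        List.replicate_zero, List.append_nil]
      rw [pads_map_some_append_iff]
      exact ⟨(h c).drop K, (List.take_append_drop _ _).symm, _, rfl⟩
    · refine ⟨(K - (h c).length) + K, ?_⟩
      simp [blockPad, i, fst, snd, List.take_of_length_le hc, List.drop_of_length_le hc]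
  have : Finite Γ := List.finite_length_le α K
  refine ((hE.comp (hR.comap_blockPad (h := i) (h' := i) (fun c => c.2) (fun c => c.2))).comp
    hE.swap).of_iff fun t t' => ?_
  constructor
  · rintro ⟨⟨x, c, ht, hx⟩, ⟨x', c', ht', hx'⟩, hR⟩
    exact ⟨_, ⟨_, ⟨x, hx, _, _, ⟨c, rfl, rfl⟩, ht, rfl⟩, _, _, hR, hpad x hx c ht rfl,
      hpad x' hx' c' ht' rfl⟩, x', hx', _, _, ⟨c', rfl, rfl⟩, ht', rfl⟩
  · rintro ⟨w', ⟨w, ⟨x, hx, _, _, ⟨c, rfl, rfl⟩, ht, hw⟩, u, u', hR, hu, hu'⟩,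
      x', hx', _, _, ⟨c', rfl, rfl⟩, ht', hw'⟩
    refine ⟨⟨x, c, ht, hx⟩, ⟨x', c', ht', hx'⟩, ?_⟩
    rwa [(hpad x hx c ht hw).unique hu, (hpad x' hx' c' ht' hw').unique hu']

section Monoid

variable {α : Type*} {M : Type*} [Monoid M]

/-- The value of a word in a monoid. -/
def wordProd (φ : α → M) (w : List α) : M := (w.map φ).prod

@[simp]
theorem wordProd_nil (φ : α → M) : wordProd φ [] = 1 := rfl

@[simp]
theorem wordProd_cons (φ : α → M) (a : α) (w : List α) :
    wordProd φ (a :: w) = φ a * wordProd φ w := by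
  simp [wordProd]

@[simp]
theorem wordProd_append (φ : α → M) (u v : List α) :
    wordProd φ (u ++ v) = wordProd φ u * wordProd φ v := by
  simp [wordProd]

theorem wordProd_map {β : Type*} (φ : α → M) (g : β → α) (w : List β) :
    wordProd φ (w.map g) = wordProd (φ ∘ g) w := by
  simp [wordProd]

theorem wordProd_flatMap {β : Type*} (φ : α → M) (g : β → List α) (w : List β) :
    wordProd φ (w.flatMap g) = wordProd (fun b => wordProd φ (g b)) w := by
  induction w with
  | nil => rfl
  | cons b w ih => simp [ih]

theorem wordProd_mem {φ : α → M} {N : Set M} (hφ : ∀ a, φ a ∈ N)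
    (hN : ∀ m ∈ N, ∀ n ∈ N, m * n ∈ N) {w : List α} (hw : w ≠ []) : wordProd φ w ∈ N := by
  induction w with
  | nil => exact (hw rfl).elim
  | cons a w ih =>
    rw [wordProd_cons]
    by_cases h : w = []
    · simpa [h] using hφ a
    · exact hN _ (hφ a) _ (ih h)

/-- An automatic structure for a subsemigroup `N` of a monoid. -/
structure IsAutomaticIn (φ : α → M) (N : Set M) (L : Language α) : Prop where
  letter_mem : ∀ a, φ a ∈ N
  nonempty_words : ∀ w ∈ L, w ≠ []
  regular : L.IsRegular
  onto : ∀ m ∈ N, ∃ w ∈ L, wordProd φ w = m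
  eq_regular : RegRel fun u v => u ∈ L ∧ v ∈ L ∧ wordProd φ u = wordProd φ v
  mul_regular : ∀ a, RegRel fun u v => u ∈ L ∧ v ∈ L ∧ wordProd φ u * φ a = wordProd φ v

namespace IsAutomaticIn

variable {φ : α → M} {N : Set M} {L : Language α}

theorem isRegular_fiber (h : IsAutomaticIn φ N L) (m : M) :
    Language.IsRegular {v | v ∈ L ∧ wordProd φ v = m} := by
  by_cases hm : ∃ u ∈ L, wordProd φ u = m
  · obtain ⟨u, hu, rfl⟩ := hm
    refine (h.eq_regular.and
      (RegRel.prod h.regular (Language.isRegular_singleton u))).dom.congr fun v => ?_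
    constructor
    · rintro ⟨hv, e⟩
      exact ⟨u, ⟨hv, hu, e⟩, hv, rfl⟩
    · rintro ⟨_, ⟨hv, -, e⟩, -, rfl⟩
      exact ⟨hv, e⟩
  · refine Language.isRegular_zero.congr fun v => ?_
    exact ⟨fun hv => (hm ⟨v, hv⟩).elim, fun hv => hv.elim⟩

variable (h : IsAutomaticIn φ N L) (hN : ∀ m ∈ N, ∀ n ∈ N, m * n ∈ N) (h1 : (1 : M) ∉ N)
include h hN

theorem wordProd_mem {w : List α} (hw : w ∈ L) : wordProd φ w ∈ N :=
  AutoSg.wordProd_mem h.letter_mem hN (h.nonempty_words w hw)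

theorem exists_rep (w : List α) : ∃ v, (v ∈ L ∨ v = []) ∧ wordProd φ v = wordProd φ w := by
  by_cases hw : w = []
  · exact ⟨[], Or.inr rfl, by rw [hw]⟩
  · obtain ⟨v, hv, e⟩ := h.onto _ (AutoSg.wordProd_mem h.letter_mem hN hw)
    exact ⟨v, Or.inl hv, e⟩

include h1

theorem regRel_mul_word (z : List α) :
    RegRel fun u v => (u ∈ L ∨ u = []) ∧ (v ∈ L ∨ v = []) ∧
      wordProd φ u * wordProd φ z = wordProd φ v := by
  have hne {w : List α} (hw : w ≠ []) : wordProd φ w ≠ 1 := fun e =>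
    h1 (e ▸ AutoSg.wordProd_mem h.letter_mem hN hw)
  induction z using List.reverseRecOn with
  | nil =>
    refine (h.eq_regular.or (RegRel.prod (Language.isRegular_singleton [])
      (Language.isRegular_singleton []))).of_iff fun u v => ?_
    constructor
    · rintro ⟨hu | rfl, hv | rfl, e⟩
      · exact Or.inl ⟨hu, hv, by simpa using e⟩
      · exact (hne (h.nonempty_words u hu) (by simpa using e)).elim
      · exact (hne (h.nonempty_words v hv) (by simpa using e.symm)).elim
      · exact Or.inr ⟨rfl, rfl⟩
    · rintro (⟨hu, hv, e⟩ | ⟨rfl, rfl⟩)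
      · exact ⟨Or.inl hu, Or.inl hv, by simpa using e⟩
      · exact ⟨Or.inr rfl, Or.inr rfl, by simp⟩
  | append_singleton z a ih =>
    refine (ih.comp ((h.mul_regular a).or (RegRel.prod (Language.isRegular_singleton [])
      (h.isRegular_fiber (φ a))))).of_iff fun u v => ?_
    constructor
    · rintro ⟨hu, hv, e⟩
      obtain ⟨w, hw, hwe⟩ := h.exists_rep hN (u ++ z)
      have e' : wordProd φ v = wordProd φ w * φ a := by
        rw [hwe, ← e]
        simp [mul_assoc]
      have hv' : v ∈ L := by
        refine hv.resolve_right ?_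
        rintro rfl
        exact hne (w := w ++ [a]) (by simp) (by simpa using e'.symm)
      refine ⟨w, ⟨hu, hw, by simpa using hwe.symm⟩, ?_⟩
      rcases hw with hw | rfl
      · exact Or.inl ⟨hw, hv', e'.symm⟩
      · exact Or.inr ⟨rfl, hv', by simpa using e'⟩
    · rintro ⟨w, ⟨hu, -, e⟩, ⟨hw, hv, e'⟩ | ⟨rfl, hv, e'⟩⟩
      · exact ⟨hu, Or.inl hv, by simp [← mul_assoc, e, e']⟩
      · exact ⟨hu, Or.inl hv, by simp [← mul_assoc, e, e']⟩

end IsAutomaticIn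

theorem isRegular_wordProd_mul_eq {φ : α → M} {F : Set M} (hF : F.Finite)
    (hφ : ∀ a m, φ a * m ∈ F → m ∈ F) {f g : M} (hg : g ∈ F) :
    Language.IsRegular {y | wordProd φ y * f = g} := by
  have hw (x : List α) (m : M) (hm : wordProd φ x * m ∈ F) : m ∈ F := by
    induction x generalizing m with
    | nil => simpa using hm
    | cons a x ih =>
      rw [wordProd_cons, mul_assoc] at hm
      exact ih _ (hφ _ _ hm)
  have := hF.to_subtype
  refine Language.isRegular_of_invariant (σ := Set F)
    (fun x => {m | wordProd φ x * m = g}) ?_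
  intro x x' hx y hy
  change wordProd φ (x ++ y) * f = g at hy
  change wordProd φ (x' ++ y) * f = g
  rw [wordProd_append, mul_assoc] at hy ⊢
  have hm : (⟨_, hw x _ (hy ▸ hg)⟩ : F) ∈ {m : F | wordProd φ x * m = g} := hy
  rw [hx] at hm
  exact hm

section Extend

variable {φ : α → M} {N : Set M} {L : Language α}

theorem IsAutomaticIn.regRel_mul_of_notMem [Finite α] (h : IsAutomaticIn φ N L)
    (hN : ∀ m ∈ N, ∀ n ∈ N, m * n ∈ N) (h1 : (1 : M) ∉ N)
    (hM : ∀ m n : M, m * n = 1 → n = 1) (hfin : {m : M | m ≠ 1 ∧ m ∉ N}.Finite)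
    (hF : ∀ a m, φ a * m ∈ {m : M | m ≠ 1 ∧ m ∉ N} → m ∈ {m : M | m ≠ 1 ∧ m ∉ N})
    {f : M} (hf : f ≠ 1 ∧ f ∉ N) :
    RegRel fun u v => u ∈ L ∧ v ∈ L ∧ wordProd φ u * f = wordProd φ v := by
  have hsplit (u : List α) (hu : wordProd φ u * f ∈ N) : ∃ x a y, u = x ++ a :: y ∧
      (wordProd φ y * f ≠ 1 ∧ wordProd φ y * f ∉ N) ∧ φ a * (wordProd φ y * f) ∈ N := by
    induction u with
    | nil => exact (hf.2 (by simpa using hu)).elim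
    | cons a u ih =>
      by_cases hu' : wordProd φ u * f ∈ N
      · obtain ⟨x, b, y, rfl, hy⟩ := ih hu'
        exact ⟨a :: x, b, y, rfl, hy⟩
      · exact ⟨[], a, u, rfl, ⟨fun e => hf.1 (hM _ _ e), hu'⟩, by simpa [mul_assoc] using hu⟩
  obtain ⟨σ, _, D, hD⟩ := Language.exists_dfa h.regular
  have := hfin.to_subtype
  let K (q : σ) (g : M) : Language α := {y | D.evalFrom q y ∈ D.accept ∧ wordProd φ y * f = g}
  have hK (q : σ) (g : {m : M | m ≠ 1 ∧ m ∉ N}) : (K q g).IsRegular := by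
    refine Language.IsRegular.inf (Language.isRegular_of_invariant
      (L := {y | D.evalFrom q y ∈ D.accept}) (D.evalFrom q) ?_)
      (isRegular_wordProd_mul_eq hfin hF g.2)
    intro x x' hx y hy
    change D.evalFrom q (x ++ y) ∈ D.accept at hy
    change D.evalFrom q (x' ++ y) ∈ D.accept
    rw [DFA.evalFrom_of_append] at hy ⊢
    rwa [← hx]
  let I := {i : σ × α × {m : M | m ≠ 1 ∧ m ∉ N} //
    φ i.2.1 * i.2.2 ∈ N ∧ ∃ y, y ∈ K i.1 i.2.2}
  have hI (i : I) : ∃ z, wordProd φ z = φ i.1.2.1 * i.1.2.2 := by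
    obtain ⟨z, -, hz⟩ := h.onto _ i.2.1
    exact ⟨z, hz⟩
  choose z hz using hI
  choose y₀ hy₀ using fun i : I => i.2.2
  have hx (q : σ) : Language.IsRegular {x | D.eval x = q} := by
    refine Language.isRegular_of_invariant D.eval fun x x' hx y hy => ?_
    change D.evalFrom _ (x ++ y) = q at hy
    change D.evalFrom _ (x' ++ y) = q
    rw [DFA.evalFrom_of_append] at hy ⊢
    exact (congrArg (D.evalFrom · y) hx).symm.trans hy
  have hR := RegRel.iUnion fun i : I => ((RegRel.prod (hK i.1.1 i.1.2.2)
    (Language.isRegular_singleton (y₀ i))).prepend (hx i.1.1) id).comp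
      ((h.regRel_mul_word hN h1 (φ := φ) (i.1.2.1 :: y₀ i)).swap.comp
        (h.regRel_mul_word hN h1 (z i)))
  refine (hR.and (RegRel.prod h.regular h.regular)).of_iff fun u v => ?_
  constructor
  · rintro ⟨hu, hv, e⟩
    refine ⟨?_, hu, hv⟩
    obtain ⟨x, a, y, rfl, hy, hay⟩ := hsplit u (e ▸ h.wordProd_mem hN hv)
    have hxy : (x ++ [a]) ++ y ∈ L := by simpa using hu
    let i : I := ⟨(D.eval (x ++ [a]), a, ⟨_, hy⟩), hay, y, (hD _ _).1 hxy, rfl⟩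
    obtain ⟨w, hw, hwx⟩ := h.exists_rep hN x
    have hmem : (x ++ [a]) ++ y₀ i ∈ L := (hD _ _).2 (hy₀ i).1
    refine ⟨i, (x ++ [a]) ++ y₀ i, ⟨x ++ [a], rfl, y, y₀ i, ⟨⟨(hD _ _).1 hxy, rfl⟩, rfl⟩,
      by simp, by simp⟩, w, ⟨hw, Or.inl hmem, ?_⟩, hw, Or.inl hv, ?_⟩
    · simp [hwx, i]
    · rw [hz, hwx, ← e]
      simp [i, mul_assoc]
  · rintro ⟨⟨i, u₀, ⟨x, -, y, _, ⟨hy, rfl⟩, rfl, rfl⟩, w, ⟨-, -, e₁⟩, -, -, e₂⟩, hu, hv⟩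
    refine ⟨hu, hv, ?_⟩
    rw [← e₂, hz, ← (hy₀ i).2, wordProd_append, mul_assoc, hy.2, ← (hy₀ i).2]
    simp only [List.map_id, wordProd_append, wordProd_cons] at e₁
    simp only [← mul_assoc] at e₁ ⊢
    rw [e₁]

theorem IsAutomaticIn.extend [Finite α] (h : IsAutomaticIn φ N L)
    (hN : ∀ m ∈ N, ∀ n ∈ N, m * n ∈ N) (h1 : (1 : M) ∉ N)
    (hM : ∀ m n : M, m * n = 1 → n = 1) {κ : Type*} [Finite κ] {e : κ → M}
    (he : Set.range e = {m : M | m ≠ 1 ∧ m ∉ N}) :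
    IsAutomaticIn (Sum.elim φ e) {1}ᶜ
      {w | (∃ u ∈ L, w = u.map Sum.inl) ∨ ∃ k, w = [Sum.inr k]} := by
  have hek (k) : e k ≠ 1 ∧ e k ∉ N := he.subset ⟨k, rfl⟩
  have hfin : {m : M | m ≠ 1 ∧ m ∉ N}.Finite := he ▸ Set.finite_range e
  have hF (a : α) (m : M) (hm : φ a * m ∈ {m : M | m ≠ 1 ∧ m ∉ N}) :
      m ∈ {m : M | m ≠ 1 ∧ m ∉ N} := by
    refine ⟨?_, fun hm' => hm.2 (hN _ (h.letter_mem a) _ hm')⟩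
    rintro rfl
    exact hm.2 (by simpa using h.letter_mem a)
  have hinl (u : List α) : wordProd (Sum.elim φ e) (u.map Sum.inl) = wordProd φ u := by
    rw [wordProd_map]
    rfl
  have key (m : M) (hR : RegRel fun u v => u ∈ L ∧ v ∈ L ∧ wordProd φ u * m = wordProd φ v)
      (hm : ∀ k, Language.IsRegular {u | u ∈ L ∧ wordProd φ u * m = e k}) :
      RegRel fun u v => u ∈ {w | (∃ u ∈ L, w = u.map Sum.inl) ∨ ∃ k, w = [Sum.inr k]} ∧
        v ∈ {w | (∃ u ∈ L, w = u.map Sum.inl) ∨ ∃ k, w = [Sum.inr k]} ∧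
        wordProd (Sum.elim φ e) u * m = wordProd (Sum.elim φ e) v := by
    have h₁ := hR.map (Sum.inl : α → α ⊕ κ) (Sum.inl : α → α ⊕ κ)
    have h₂ := RegRel.iUnion fun k => RegRel.prod ((hm k).map (Sum.inl : α → α ⊕ κ))
      (Language.isRegular_singleton [(Sum.inr k : α ⊕ κ)])
    have h₃ := RegRel.iUnion fun k => RegRel.prod
      (Language.isRegular_singleton [(Sum.inr k : α ⊕ κ)])
      ((h.isRegular_fiber (e k * m)).map (Sum.inl : α → α ⊕ κ))
    have h₄ := RegRel.iUnion fun p : {p : κ × κ // e p.1 * m = e p.2} => RegRel.prod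
      (Language.isRegular_singleton [(Sum.inr p.1.1 : α ⊕ κ)])
      (Language.isRegular_singleton [(Sum.inr p.1.2 : α ⊕ κ)])
    refine (h₁.or (h₂.or (h₃.or h₄))).of_iff fun u v => ?_
    constructor
    · rintro ⟨⟨u, hu, rfl⟩ | ⟨k, rfl⟩, ⟨v, hv, rfl⟩ | ⟨l, rfl⟩, E⟩
      · rw [hinl, hinl] at E
        exact Or.inl ⟨u, v, ⟨hu, hv, E⟩, rfl, rfl⟩
      · rw [hinl] at E
        exact Or.inr (Or.inl ⟨l, ⟨u, ⟨hu, by simpa using E⟩, rfl⟩, rfl⟩)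
      · rw [hinl] at E
        exact Or.inr (Or.inr (Or.inl ⟨k, rfl, ⟨v, ⟨hv, by simpa using E.symm⟩, rfl⟩⟩))
      · exact Or.inr (Or.inr (Or.inr ⟨⟨(k, l), by simpa using E⟩, rfl, rfl⟩))
    · rintro (⟨u, v, ⟨hu, hv, E⟩, rfl, rfl⟩ | ⟨l, ⟨u, ⟨hu, E⟩, rfl⟩, rfl⟩ |
        ⟨k, rfl, ⟨v, ⟨hv, E⟩, rfl⟩⟩ | ⟨⟨⟨k, l⟩, E⟩, rfl, rfl⟩)
      · exact ⟨Or.inl ⟨u, hu, rfl⟩, Or.inl ⟨v, hv, rfl⟩, by rw [hinl, hinl, E]⟩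
      · exact ⟨Or.inl ⟨u, hu, rfl⟩, Or.inr ⟨l, rfl⟩, by rw [hinl, E]; simp⟩
      · exact ⟨Or.inr ⟨k, rfl⟩, Or.inl ⟨v, hv, rfl⟩, by rw [hinl, E]; simp⟩
      · exact ⟨Or.inr ⟨k, rfl⟩, Or.inr ⟨l, rfl⟩, by simpa using E⟩
  have hempty {m : M} (hm : ∀ u ∈ L, wordProd φ u * m ∈ N) (k) :
      Language.IsRegular {u | u ∈ L ∧ wordProd φ u * m = e k} := by
    refine Language.isRegular_zero.congr fun u => ⟨?_, fun hu => hu.elim⟩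
    rintro ⟨hu, E⟩
    exact ((hek k).2 (E ▸ hm u hu)).elim
  refine ⟨?_, ?_, ?_, ?_, ?_, ?_⟩
  · rintro (a | k)
    · exact fun (E : φ a = 1) => h1 (E ▸ h.letter_mem a)
    · exact (hek k).1
  · rintro w (⟨u, hu, rfl⟩ | ⟨k, rfl⟩)
    · simpa using h.nonempty_words u hu
    · simp
  · refine Language.IsRegular.congr (Language.IsRegular.add (h.regular.map Sum.inl)
      (Language.IsRegular.iUnion fun k => Language.isRegular_singleton [(Sum.inr k : α ⊕ κ)]))
      fun w => ?_
    constructor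
    · rintro (⟨u, hu, rfl⟩ | ⟨k, rfl⟩)
      · exact Or.inl ⟨u, hu, rfl⟩
      · exact Or.inr ⟨k, rfl⟩
    · rintro (⟨u, hu, rfl⟩ | ⟨k, rfl⟩)
      · exact Or.inl ⟨u, hu, rfl⟩
      · exact Or.inr ⟨k, rfl⟩
  · intro m hm
    by_cases hmN : m ∈ N
    · obtain ⟨w, hw, rfl⟩ := h.onto m hmN
      exact ⟨_, Or.inl ⟨w, hw, rfl⟩, hinl w⟩
    · obtain ⟨k, rfl⟩ := he.superset (show m ≠ 1 ∧ m ∉ N from ⟨hm, hmN⟩)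
      exact ⟨_, Or.inr ⟨k, rfl⟩, by simp⟩
  · refine (key 1 (by simpa using h.eq_regular) (hempty ?_)).of_iff fun u v => by
      rw [mul_one]
      rfl
    simpa using fun u hu => h.wordProd_mem hN hu
  · rintro (a | k)
    · exact key _ (h.mul_regular a)
        (hempty fun u hu => hN _ (h.wordProd_mem hN hu) _ (h.letter_mem a))
    · exact key _ (h.regRel_mul_of_notMem hN h1 hM hfin hF (hek k))
        fun l => Language.IsRegular.inf h.regular (isRegular_wordProd_mul_eq hfin hF (hek l))

end Extend

section Restrict

variable {φ : α → M} {N : Set M} {L : Language α}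

/-- The words of `L` that are of minimal length among those with the same value. -/
def shortest (φ : α → M) (L : Language α) : Language α :=
  {u | u ∈ L ∧ ∀ v ∈ L, wordProd φ u = wordProd φ v → u.length ≤ v.length}

theorem IsAutomaticIn.isRegular_shortest (h : IsAutomaticIn φ N L) :
    (shortest φ L).IsRegular := by
  refine (Language.IsRegular.inf h.regular
    (h.eq_regular.and regRel_length_lt).dom.compl).congr fun u => ?_
  constructor
  · rintro ⟨hu, hmin⟩
    exact ⟨hu, fun ⟨v, ⟨_, hv, e⟩, hlt⟩ => (hmin v hv e).not_gt hlt⟩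
  · rintro ⟨hu, hmin⟩
    exact ⟨hu, fun v hv e => not_lt.1 fun hlt => hmin ⟨v, ⟨hu, hv, e⟩, hlt⟩⟩

theorem exists_mem_shortest {u : List α} (hu : u ∈ L) :
    ∃ v ∈ shortest φ L, wordProd φ v = wordProd φ u := by
  obtain ⟨v, ⟨hv, e⟩, hmin⟩ := exists_minimalFor_of_wellFoundedLT
    (fun v => v ∈ L ∧ wordProd φ v = wordProd φ u) List.length ⟨u, hu, rfl⟩
  refine ⟨v, ⟨hv, fun w hw hvw => ?_⟩, e⟩
  by_contra hlt
  exact hlt (hmin ⟨hw, hvw.symm.trans e⟩ (not_le.1 hlt).le)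

theorem exists_factor_length_le (hL : L.IsRegular) {F : Set M} (hF : F.Finite) :
    ∃ K, ∀ x y z, x ++ y ++ z ∈ shortest φ L → wordProd φ y ∈ F → y.length ≤ K := by
  obtain ⟨σ, _, D, hD⟩ := Language.exists_dfa hL
  have := hF.to_subtype
  have hn (i : σ × σ × F) : ∃ n, ∀ x y z, x ++ y ++ z ∈ shortest φ L → D.eval x = i.1 →
      D.evalFrom i.1 y = i.2.1 → wordProd φ y = i.2.2 → y.length ≤ n := by
    by_cases hi : ∃ y, D.evalFrom i.1 y = i.2.1 ∧ wordProd φ y = i.2.2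
    · obtain ⟨y₀, hq, hy₀⟩ := hi
      refine ⟨y₀.length, fun x y z hxyz hx hy hyv => ?_⟩
      have hmem : x ++ y₀ ++ z ∈ L := by
        have := hxyz.1
        rw [List.append_assoc, hD, hx, DFA.evalFrom_of_append] at this ⊢
        rwa [hq, ← hy]
      have := hxyz.2 _ hmem (by simp [hyv, hy₀])
      simp only [List.length_append] at this
      omega
    · exact ⟨0, fun x y z _ _ hy hyv => (hi ⟨y, hy, hyv⟩).elim⟩
  choose n hn using hn
  obtain ⟨K, hK⟩ := (Set.finite_range n).bddAbove
  exact ⟨K, fun x y z h hy => (hn (D.eval x, D.evalFrom (D.eval x) y, ⟨_, hy⟩) x y z h rfl rfl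
    rfl).trans (hK ⟨_, rfl⟩)⟩

theorem IsAutomaticIn.restrict [Finite α] (h : IsAutomaticIn φ {1}ᶜ L)
    (hM : ∀ m n : M, m * n = 1 → n = 1)
    (h1 : (1 : M) ∉ N) (hfin : {m : M | m ≠ 1 ∧ m ∉ N}.Finite) :
    ∃ n : ℕ, ∃ L' : Language {l : List α // l.length ≤ n ∧ wordProd φ l ∈ N},
      IsAutomaticIn (fun l => wordProd φ l.1) N L' := by
  obtain ⟨K, hK⟩ := exists_factor_length_le (φ := φ) h.regular hfin
  have hN₁ : ∀ m ∈ ({1}ᶜ : Set M), ∀ n ∈ ({1}ᶜ : Set M), m * n ∈ ({1}ᶜ : Set M) :=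
    fun m _ n hn e => hn (hM m n e)
  have hfac (x y z : List α) (hxyz : x ++ y ++ z ∈ shortest φ L) (hy : K < y.length) :
      wordProd φ y ∈ N := by
    by_contra hyN
    refine hy.not_ge (hK x y z hxyz ⟨?_, hyN⟩)
    refine AutoSg.wordProd_mem h.letter_mem hN₁ ?_
    rintro rfl
    simp at hy
  let B := {l : List α // l.length ≤ 2 * (K + 1) ∧ wordProd φ l ∈ N}
  let g : B → List α := Subtype.val
  have hB : Finite B := (List.finite_length_le α (2 * (K + 1))).subset fun l hl => hl.1
  have hchop (u : List α) (hu : u ∈ shortest φ L) (n : ℕ) : ∀ x s, x ++ s = u → s.length = n →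
      wordProd φ s ∈ N → ∃ t : List B, IsChopped (K + 1) g t ∧ t.flatMap g = s := by
    induction n using Nat.strong_induction_on with
    | _ n ih =>
      rintro x s rfl rfl hs
      by_cases hlen : s.length ≤ 2 * (K + 1)
      · exact ⟨[⟨s, hlen, hs⟩], ⟨[], _, rfl, by simp⟩, by simp [g]⟩
      · have htake : (s.take (K + 1)).length = K + 1 := by simp; omega
        have hdrop : (s.drop (K + 1)).length = s.length - (K + 1) := by simp
        have e : x ++ s.take (K + 1) ++ s.drop (K + 1) = x ++ s := by simp
        obtain ⟨t, ⟨y, c, rfl, hy⟩, ht⟩ := ih _ (by omega) (x ++ s.take (K + 1))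
          (s.drop (K + 1)) e hdrop (hfac (x ++ s.take (K + 1)) _ [] (by simpa [e] using hu)
            (by omega))
        refine ⟨⟨s.take (K + 1), by omega, hfac x _ (s.drop (K + 1)) (by rwa [e]) (by omega)⟩ ::
          (y ++ [c]), ⟨_ :: y, c, rfl, ?_⟩, ?_⟩
        · rintro b (_ | ⟨_, hb⟩)
          · exact htake
          · exact hy b hb
        · rw [List.flatMap_cons, ht]
          exact List.take_append_drop _ _
  have hrel {R : List α → List α → Prop} (hR : RegRel R) :
      RegRel fun t t' => IsChopped (K + 1) g t ∧ IsChopped (K + 1) g t' ∧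
        t.flatMap g ∈ shortest φ L ∧ t'.flatMap g ∈ shortest φ L ∧
        R (t.flatMap g) (t'.flatMap g) :=
    (((RegRel.prod h.isRegular_shortest h.isRegular_shortest).and hR).comap_chopped
      (h := g) fun b => b.2.1).of_iff fun t t' => by simp only [and_assoc]
  have hval (t : List B) : wordProd (fun l : B => wordProd φ l.1) t = wordProd φ (t.flatMap g) :=
    (wordProd_flatMap φ g t).symm
  refine ⟨2 * (K + 1), {t | IsChopped (K + 1) g t ∧ t.flatMap g ∈ shortest φ L},
    fun b => b.2.2, ?_, ?_, ?_, ?_, fun b => ?_⟩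
  · rintro t ⟨⟨x, c, rfl, -⟩, -⟩
    simp
  · refine (hrel h.eq_regular).dom.congr fun t => ?_
    constructor
    · rintro ⟨ht, htL⟩
      exact ⟨t, ht, ht, htL, htL, htL.1, htL.1, rfl⟩
    · rintro ⟨t', ht, -, htL, -⟩
      exact ⟨ht, htL⟩
  · intro m hm
    obtain ⟨u, hu, rfl⟩ := h.onto m fun e => h1 (e ▸ hm)
    obtain ⟨v, hv, e⟩ := exists_mem_shortest (φ := φ) hu
    obtain ⟨t, ht, rfl⟩ := hchop v hv _ [] v rfl rfl (e ▸ hm)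
    exact ⟨t, ⟨ht, hv⟩, (hval t).trans e⟩
  · refine (hrel h.eq_regular).of_iff fun t t' => ?_
    rw [hval, hval]
    constructor
    · rintro ⟨⟨ht, htL⟩, ⟨ht', htL'⟩, e⟩
      exact ⟨ht, ht', htL, htL', htL.1, htL'.1, e⟩
    · rintro ⟨ht, ht', htL, htL', -, -, e⟩
      exact ⟨⟨ht, htL⟩, ⟨ht', htL'⟩, e⟩
  · refine (hrel (h.regRel_mul_word hN₁ (by simp) b.1)).of_iff fun t t' => ?_
    rw [hval, hval]
    constructor
    · rintro ⟨⟨ht, htL⟩, ⟨ht', htL'⟩, e⟩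
      exact ⟨ht, ht', htL, htL', Or.inl htL.1, Or.inl htL'.1, e⟩
    · rintro ⟨ht, ht', htL, htL', -, -, e⟩
      exact ⟨⟨ht, htL⟩, ⟨ht', htL'⟩, e⟩

end Restrict

end Monoid

section WithOne

variable {S U : Type*} [Semigroup S] [Semigroup U] (ι : U →ₙ* S) {α : Type*} (ψ : α → U)

theorem coe_foldl_mul (w : List α) (s : U) :
    ((ι ((w.map ψ).foldl (· * ·) s) : S) : WithOne S) =
      (ι s : S) * wordProd (fun a => ((ι (ψ a) : S) : WithOne S)) w := by
  induction w generalizing s with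
  | nil => simp
  | cons a w ih =>
    rw [List.map_cons, List.foldl_cons, ih, map_mul, WithOne.coe_mul, wordProd_cons, mul_assoc]

theorem exists_evalWord_eq {w : List α} (hw : w ≠ []) : ∃ s, evalWord ψ w = some s ∧
    wordProd (fun a => ((ι (ψ a) : S) : WithOne S)) w = (ι s : S) := by
  cases w with
  | nil => exact (hw rfl).elim
  | cons a w => exact ⟨_, rfl, by rw [wordProd_cons, ← coe_foldl_mul ι ψ]⟩

variable {ι}

theorem evalWord_eq_some_iff (hι : Function.Injective ι) {w : List α} (hw : w ≠ []) {s : U} :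
    evalWord ψ w = some s ↔
      wordProd (fun a => ((ι (ψ a) : S) : WithOne S)) w = (ι s : S) := by
  obtain ⟨t, ht, e⟩ := exists_evalWord_eq ι ψ hw
  rw [ht, e, Option.some.injEq, WithOne.coe_inj, hι.eq_iff]

theorem evalWord_eq_iff (hι : Function.Injective ι) {u v : List α} (hu : u ≠ []) (hv : v ≠ []) :
    evalWord ψ u = evalWord ψ v ↔ wordProd (fun a => ((ι (ψ a) : S) : WithOne S)) u =
      wordProd (fun a => ((ι (ψ a) : S) : WithOne S)) v := by
  obtain ⟨t, ht, e⟩ := exists_evalWord_eq ι ψ hv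
  rw [ht, e, evalWord_eq_some_iff ψ hι hu]

theorem isAutomaticStructure_iff [Finite α] (hι : Function.Injective ι) (L : Language α) :
    IsAutomaticStructure U ψ L ↔ IsAutomaticIn (fun a => ((ι (ψ a) : S) : WithOne S))
      (Set.range fun s => ((ι s : S) : WithOne S)) L := by
  have heq (hL : ∀ w ∈ L, w ≠ []) (z : List α) :
      Language.IsRegular {p : List (Option α × Option α) | ∃ u ∈ L, ∃ v ∈ L, p = padMap u v ∧
        evalWord ψ (u ++ z) = evalWord ψ v} ↔
      RegRel fun u v => u ∈ L ∧ v ∈ L ∧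
        wordProd (fun a => ((ι (ψ a) : S) : WithOne S)) (u ++ z) =
          wordProd (fun a => ((ι (ψ a) : S) : WithOne S)) v := by
    rw [← isRegular_padMap_iff]
    refine iff_of_eq (congrArg Language.IsRegular (Language.ext fun p => ?_))
    constructor
    · rintro ⟨u, hu, v, hv, rfl, e⟩
      exact ⟨u, v, ⟨hu, hv, (evalWord_eq_iff ψ hι (by simp [hL u hu]) (hL v hv)).1 e⟩, rfl⟩
    · rintro ⟨u, v, ⟨hu, hv, e⟩, rfl⟩
      exact ⟨u, hu, v, hv, rfl, (evalWord_eq_iff ψ hι (by simp [hL u hu]) (hL v hv)).2 e⟩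
  constructor
  · intro h
    refine ⟨fun a => ⟨ψ a, rfl⟩, h.nonempty_words, h.regular, ?_, ?_, fun a => ?_⟩
    · rintro _ ⟨s, rfl⟩
      obtain ⟨w, hw, e⟩ := h.onto s
      exact ⟨w, hw, (evalWord_eq_some_iff ψ hι (h.nonempty_words w hw)).1 e⟩
    · simpa using (heq h.nonempty_words []).1 (by simpa using h.eq_regular)
    · simpa using (heq h.nonempty_words [a]).1 (h.mul_regular a)
  · intro h
    refine ⟨h.nonempty_words, h.regular, fun s => ?_, ?_, fun a => ?_⟩
    · obtain ⟨w, hw, e⟩ := h.onto _ ⟨s, rfl⟩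
      exact ⟨w, hw, (evalWord_eq_some_iff ψ hι (h.nonempty_words w hw)).2 e⟩
    · simpa using (heq h.nonempty_words []).2 (by simpa using h.eq_regular)
    · exact (heq h.nonempty_words [a]).2 (by simpa using h.mul_regular a)

theorem isAutomaticSemigroup_iff (hι : Function.Injective ι) :
    IsAutomaticSemigroup U ↔ ∃ (A : Type) (_ : Finite A) (φ : A → WithOne S) (L : Language A),
      IsAutomaticIn φ (Set.range fun s => ((ι s : S) : WithOne S)) L := by
  constructor
  · rintro ⟨A, _, ψ, L, h⟩
    exact ⟨A, ‹_›, _, L, (isAutomaticStructure_iff ψ hι L).1 h⟩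
  · rintro ⟨A, _, φ, L, h⟩
    choose ψ hψ using h.letter_mem
    obtain rfl : (fun a => ((ι (ψ a) : S) : WithOne S)) = φ := funext hψ
    exact ⟨A, ‹_›, ψ, L, (isAutomaticStructure_iff ψ hι L).2 h⟩

end WithOne

end AutoSg

open AutoSg in
/-- A semigroup with a subsemigroup of finite Rees index is automatic
iff the subsemigroup is automatic. -/
theorem finite_rees_index_automatic (S : Type*) [Semigroup S] (T : Subsemigroup S)
    (hfin : ((T : Set S)ᶜ).Finite) :
    IsAutomaticSemigroup S ↔ IsAutomaticSemigroup T := by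
  have hrange : (Set.range fun s => ((MulHom.id S s : S) : WithOne S)) = {1}ᶜ := by
    ext m
    simp [← WithOne.ne_one_iff_exists]
  have hcoe (s : S) : (s : WithOne S) ∈ (Set.range fun t : T =>
      ((MulMemClass.subtype T t : S) : WithOne S)) ↔ s ∈ T := by
    simp
  set N := Set.range fun t : T => ((MulMemClass.subtype T t : S) : WithOne S)
  have hN : ∀ m ∈ N, ∀ n ∈ N, m * n ∈ N := by
    rintro _ ⟨s, rfl⟩ _ ⟨t, rfl⟩
    exact ⟨s * t, by simp⟩
  have h1 : (1 : WithOne S) ∉ N := by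
    rintro ⟨s, hs⟩
    exact WithOne.coe_ne_one hs
  have hM (m n : WithOne S) (h : m * n = 1) : n = 1 := by
    by_contra hn
    obtain ⟨t, rfl⟩ := WithOne.ne_one_iff_exists.1 hn
    by_cases hm : m = 1
    · simp [hm] at h
    · obtain ⟨s, rfl⟩ := WithOne.ne_one_iff_exists.1 hm
      exact WithOne.coe_ne_one h
  have hfinN : {m : WithOne S | m ≠ 1 ∧ m ∉ N}.Finite := by
    refine (hfin.image ((↑) : S → WithOne S)).subset ?_
    rintro m ⟨hm1, hmN⟩
    obtain ⟨s, rfl⟩ := WithOne.ne_one_iff_exists.1 hm1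
    exact ⟨s, fun hs => hmN ((hcoe s).2 hs), rfl⟩
  rw [isAutomaticSemigroup_iff (ι := MulHom.id S) Function.injective_id, hrange,
    isAutomaticSemigroup_iff (ι := MulMemClass.subtype T) Subtype.val_injective]
  constructor
  · rintro ⟨A, _, φ, L, h⟩
    obtain ⟨n, L', h'⟩ := h.restrict hM h1 hfinN
    exact ⟨_, (List.finite_length_le A n).subset fun l hl => hl.1, _, L', h'⟩
  · rintro ⟨A, _, φ, L, h⟩
    obtain ⟨n, ⟨e⟩⟩ := hfinN.to_subtype.exists_equiv_fin
    exact ⟨A ⊕ Fin n, inferInstance, _, _, h.extend hN h1 hM (e := fun k => (e.symm k).1)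
      (by rw [← Function.comp_def, EquivLike.range_comp]; exact Subtype.range_coe)⟩
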